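/- Let F_a and F_b be real polynomials of total degree at most 4 in two variables, and let p = (c,d) and q = (e,f) be distinct double base points: F_a, ∂F_a/∂u, ∂F_a/∂v, F_b, ∂F_b/∂u, ∂F_b/∂v all vanish at both (c,d) and (e,f). Let ι_p and ι_q be the generalised Manin involutions with degree parameter D = 4 and involution points p and q, let τ = ι_q ∘ ι_p, and let L(u,v) = (d−f)(u−e) − (c−e)(v−f), so L = 0 is the line through p and q. Then at every point (u,v) at which the defining denominators of ι_p at (u,v) and of ι_q at ι_p(u,v) are nonzero and at which F_a(u,v)·L(τ(u,v)) ≠ 0 and F_a(τ(u,v)) ≠ 0 and L(u,v) ≠ 0, the map τ is differentiable and the determinant of its total derivative equals ( L(u,v)·F_a(τ(u,v)) ) / ( L(τ(u,v))·F_a(u,v) ); that is, τ is measure preserving with density L/F_a. -/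

import Mathlib

open MvPolynomial

/-- Evaluation of a bivariate polynomial at a point of the plane. -/
noncomputable def pev (F : MvPolynomial (Fin 2) ℝ) (w : ℝ × ℝ) : ℝ :=
  eval ![w.1, w.2] F

/-- First directional quantity `F⁽¹⁾ = (c−u)Fᵤ + (d−v)Fᵥ` at `w = (u,v)`, direction point `p = (c,d)`. -/
noncomputable def d1 (F : MvPolynomial (Fin 2) ℝ) (p w : ℝ × ℝ) : ℝ :=
  (p.1 - w.1) * pev (pderiv (0 : Fin 2) F) w + (p.2 - w.2) * pev (pderiv (1 : Fin 2) F) w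

/-- Second directional quantity `F⁽²⁾` at `w = (u,v)`, direction point `p = (c,d)`. -/
noncomputable def d2 (F : MvPolynomial (Fin 2) ℝ) (p w : ℝ × ℝ) : ℝ :=
  (p.1 - w.1) ^ 2 * pev (pderiv (0 : Fin 2) (pderiv (0 : Fin 2) F)) w
    + 2 * (p.1 - w.1) * (p.2 - w.2) * pev (pderiv (1 : Fin 2) (pderiv (0 : Fin 2) F)) w
    + (p.2 - w.2) ^ 2 * pev (pderiv (1 : Fin 2) (pderiv (1 : Fin 2) F)) w

/-- `G₁ = F_a·F_b⁽¹⁾ − F_a⁽¹⁾·F_b`. -/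
noncomputable def G1 (Fa Fb : MvPolynomial (Fin 2) ℝ) (p w : ℝ × ℝ) : ℝ :=
  pev Fa w * d1 Fb p w - d1 Fa p w * pev Fb w

/-- `G₂ = F_a·F_b⁽²⁾ − F_a⁽²⁾·F_b`. -/
noncomputable def G2 (Fa Fb : MvPolynomial (Fin 2) ℝ) (p w : ℝ × ℝ) : ℝ :=
  pev Fa w * d2 Fb p w - d2 Fa p w * pev Fb w

/-- The defining denominator `2(2−D)G₁ − G₂` of the generalised Manin involution. -/
noncomputable def den (Fa Fb : MvPolynomial (Fin 2) ℝ) (D : ℕ) (p w : ℝ × ℝ) : ℝ :=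
  2 * (2 - (D : ℝ)) * G1 Fa Fb p w - G2 Fa Fb p w

/-- The generalised Manin involution `ι_p(u,v) = (u,v) + z·(p − (u,v))`
with `z = 2G₁ / (2(2−D)G₁ − G₂)`. -/
noncomputable def manin (Fa Fb : MvPolynomial (Fin 2) ℝ) (D : ℕ) (p w : ℝ × ℝ) : ℝ × ℝ :=
  w + (2 * G1 Fa Fb p w / den Fa Fb D p w) • (p - w)

/-- The linear form `L(u,v) = (d−f)(u−e) − (c−e)(v−f)` whose zero set is the line
through `p = (c,d)` and `q = (e,f)`. -/
noncomputable def lineThrough (p q w : ℝ × ℝ) : ℝ :=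
  (p.2 - q.2) * (w.1 - q.1) - (p.1 - q.1) * (w.2 - q.2)

/-- The restriction of `F` to the line `s ↦ p + s • x`, as a univariate polynomial. -/
noncomputable def linePoly (p x : ℝ × ℝ) : MvPolynomial (Fin 2) ℝ →ₐ[ℝ] Polynomial ℝ :=
  aeval ![Polynomial.C p.1 + Polynomial.X * Polynomial.C x.1,
    Polynomial.C p.2 + Polynomial.X * Polynomial.C x.2]

theorem eval_linePoly (F : MvPolynomial (Fin 2) ℝ) (p x : ℝ × ℝ) (s : ℝ) :
    (linePoly p x F).eval s = pev F (p + s • x) := by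
  unfold linePoly pev
  induction F using MvPolynomial.induction_on with
  | C a => simp
  | add F G hF hG => simp only [map_add, Polynomial.eval_add, hF, hG]
  | mul_X F i hF =>
    simp only [map_mul, Polynomial.eval_mul, hF]
    fin_cases i <;> simp [mul_comm s]

theorem natDegree_linePoly_le {F : MvPolynomial (Fin 2) ℝ} {n : ℕ} (hF : F.totalDegree ≤ n)
    (p x : ℝ × ℝ) : (linePoly p x F).natDegree ≤ n := by
  have h := aeval_natDegree_le (n := 1) F hF
    ![Polynomial.C p.1 + Polynomial.X * Polynomial.C x.1,
      Polynomial.C p.2 + Polynomial.X * Polynomial.C x.2] (by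
    intro i
    fin_cases i <;> simp <;> compute_degree)
  rwa [mul_one] at h

theorem derivative_linePoly (F : MvPolynomial (Fin 2) ℝ) (p x : ℝ × ℝ) :
    Polynomial.derivative (linePoly p x F) =
      Polynomial.C x.1 * linePoly p x (pderiv 0 F)
        + Polynomial.C x.2 * linePoly p x (pderiv 1 F) := by
  induction F using MvPolynomial.induction_on with
  | C a => simp [linePoly]
  | add F G hF hG =>
    simp only [map_add, hF, hG]
    ring
  | mul_X F i hF =>
    rw [map_mul, Polynomial.derivative_mul, hF, pderiv_mul, pderiv_mul, map_add, map_add,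
      map_mul, map_mul, map_mul, map_mul]
    fin_cases i <;> simp [linePoly, pderiv_X] <;> ring

theorem pderiv_pderiv_comm (F : MvPolynomial (Fin 2) ℝ) (i j : Fin 2) :
    pderiv i (pderiv j F) = pderiv j (pderiv i F) := by
  induction F using MvPolynomial.induction_on with
  | C a => simp
  | add F G hF hG => simp only [map_add, hF, hG]
  | mul_X F k hF =>
    have hX (a b : Fin 2) : pderiv a (pderiv b (X k : MvPolynomial (Fin 2) ℝ)) = 0 := by
      rw [pderiv_X, Pi.single_apply]
      split_ifs <;> simp
    simp only [pderiv_mul, map_add, hF, hX]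
    ring

/-- Along a line through a double zero, a polynomial of degree at most four and its directional
quantities are determined by three coefficients. -/
theorem exists_radial_coeffs {F : MvPolynomial (Fin 2) ℝ} (hF : F.totalDegree ≤ 4)
    {p : ℝ × ℝ} (h0 : pev F p = 0) (hu : pev (pderiv (0 : Fin 2) F) p = 0)
    (hv : pev (pderiv (1 : Fin 2) F) p = 0) (x : ℝ × ℝ) :
    ∃ a b c : ℝ, ∀ s : ℝ,
      pev F (p + s • x) = a * s ^ 2 + b * s ^ 3 + c * s ^ 4 ∧
      d1 F p (p + s • x) = -(2 * a * s ^ 2 + 3 * b * s ^ 3 + 4 * c * s ^ 4) ∧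
      d2 F p (p + s • x) = 2 * a * s ^ 2 + 6 * b * s ^ 3 + 12 * c * s ^ 4 := by
  set P := linePoly p x F with hP
  have hc0 : P.coeff 0 = 0 := by
    rw [Polynomial.coeff_zero_eq_eval_zero, hP, eval_linePoly]
    simpa using h0
  have hd (s : ℝ) : P.derivative.eval s = x.1 * pev (pderiv (0 : Fin 2) F) (p + s • x)
      + x.2 * pev (pderiv (1 : Fin 2) F) (p + s • x) := by
    simp [hP, derivative_linePoly, eval_linePoly]
  have hdd (s : ℝ) : P.derivative.derivative.eval s =
      x.1 ^ 2 * pev (pderiv (0 : Fin 2) (pderiv (0 : Fin 2) F)) (p + s • x)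
      + 2 * x.1 * x.2 * pev (pderiv (1 : Fin 2) (pderiv (0 : Fin 2) F)) (p + s • x)
      + x.2 ^ 2 * pev (pderiv (1 : Fin 2) (pderiv (1 : Fin 2) F)) (p + s • x) := by
    simp only [hP, derivative_linePoly, Polynomial.derivative_add, Polynomial.derivative_C_mul,
      Polynomial.eval_add, Polynomial.eval_mul, Polynomial.eval_C, eval_linePoly,
      pderiv_pderiv_comm F 0 1]
    ring
  have hc1 : P.coeff 1 = 0 := by
    have h := hd 0
    rw [← Polynomial.coeff_zero_eq_eval_zero, Polynomial.coeff_derivative] at h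
    simpa [hu, hv] using h
  have hPe : P = Polynomial.C (P.coeff 2) * Polynomial.X ^ 2
      + Polynomial.C (P.coeff 3) * Polynomial.X ^ 3
      + Polynomial.C (P.coeff 4) * Polynomial.X ^ 4 := by
    conv_lhs => rw [P.as_sum_range_C_mul_X_pow' (n := 5)
      (Nat.lt_succ_of_le (natDegree_linePoly_le hF p x))]
    simp [Finset.sum_range_succ, hc0, hc1]
  generalize P.coeff 2 = a at hPe
  generalize P.coeff 3 = b at hPe
  generalize P.coeff 4 = c at hPe
  refine ⟨a, b, c, fun s => ⟨?_, ?_, ?_⟩⟩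
  · rw [← eval_linePoly, ← hP, hPe]
    simp
  · have h := hd s
    rw [hPe] at h
    simp at h
    simp only [d1, Prod.fst_add, Prod.snd_add, Prod.smul_fst, Prod.smul_snd, smul_eq_mul]
    linear_combination s * h
  · have h := hdd s
    rw [hPe] at h
    simp at h
    simp only [d2, Prod.fst_add, Prod.snd_add, Prod.smul_fst, Prod.smul_snd, smul_eq_mul]
    linear_combination -s ^ 2 * h

@[fun_prop]
theorem differentiable_pev (F : MvPolynomial (Fin 2) ℝ) : Differentiable ℝ (pev F) := by
  unfold pev
  induction F using MvPolynomial.induction_on with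
  | C a => simp
  | add F G hF hG => simpa only [map_add] using hF.fun_add hG
  | mul_X F i hF =>
    simp only [map_mul, eval_X]
    refine hF.mul ?_
    fin_cases i
    · exact differentiable_fst
    · exact differentiable_snd

theorem differentiable_G1 (Fa Fb : MvPolynomial (Fin 2) ℝ) (p : ℝ × ℝ) :
    Differentiable ℝ (G1 Fa Fb p) := by
  unfold G1 d1
  fun_prop

theorem differentiable_den (Fa Fb : MvPolynomial (Fin 2) ℝ) (D : ℕ) (p : ℝ × ℝ) :
    Differentiable ℝ (den Fa Fb D p) := by
  unfold den G1 G2 d1 d2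
  fun_prop

theorem det_smul_id_add_smulRight (c : ℝ) (φ : ℝ × ℝ →L[ℝ] ℝ) (y : ℝ × ℝ) :
    (c • ContinuousLinearMap.id ℝ (ℝ × ℝ) + φ.smulRight y).det = c * (c + φ y) := by
  have hy : φ y = y.1 * φ (1, 0) + y.2 * φ (0, 1) := by
    have h : y = y.1 • ((1 : ℝ), (0 : ℝ)) + y.2 • ((0 : ℝ), (1 : ℝ)) := by ext <;> simp
    conv_lhs => rw [h]
    simp only [map_add, map_smul, smul_eq_mul]
  rw [ContinuousLinearMap.det, ← LinearMap.det_toMatrix (Module.Basis.finTwoProd ℝ),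
    Matrix.det_fin_two]
  simp only [LinearMap.toMatrix_apply, Module.Basis.finTwoProd_zero, Module.Basis.finTwoProd_one,
    Module.Basis.coe_finTwoProd_repr]
  simp [hy]
  ring

/-- A generalised Manin involution of a quartic pencil moves points along lines through the
involution point, and its Jacobian determinant is governed by `F_a` and the ratio of this move. -/
theorem manin_jacobian {Fa Fb : MvPolynomial (Fin 2) ℝ}
    (hFa : Fa.totalDegree ≤ 4) (hFb : Fb.totalDegree ≤ 4) {p : ℝ × ℝ}
    (hpa : pev Fa p = 0)
    (hpau : pev (pderiv (0 : Fin 2) Fa) p = 0) (hpav : pev (pderiv (1 : Fin 2) Fa) p = 0)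
    (hpb : pev Fb p = 0)
    (hpbu : pev (pderiv (0 : Fin 2) Fb) p = 0) (hpbv : pev (pderiv (1 : Fin 2) Fb) p = 0)
    {w : ℝ × ℝ} (hden : den Fa Fb 4 p w ≠ 0) :
    DifferentiableAt ℝ (manin Fa Fb 4 p) w ∧
      ∃ t : ℝ, manin Fa Fb 4 p w = p + t • (w - p) ∧
        pev Fa (manin Fa Fb 4 p w) =
          -((fderiv ℝ (manin Fa Fb 4 p) w).det * t * pev Fa w) := by
  obtain ⟨a₂, a₃, a₄, ha⟩ := exists_radial_coeffs hFa hpa hpau hpav (w - p)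
  obtain ⟨b₂, b₃, b₄, hb⟩ := exists_radial_coeffs hFb hpb hpbu hpbv (w - p)
  set z : ℝ × ℝ → ℝ := fun y => 2 * G1 Fa Fb p y / den Fa Fb 4 p y with hz
  have hzd : DifferentiableAt ℝ z w :=
    (((differentiable_G1 Fa Fb p) w).const_mul 2).mul ((differentiable_den Fa Fb 4 p w).inv hden)
  have hm : HasFDerivAt (manin Fa Fb 4 p)
      ((1 - z w) • ContinuousLinearMap.id ℝ (ℝ × ℝ) + (fderiv ℝ z w).smulRight (p - w)) w := by
    have h := (hasFDerivAt_id (𝕜 := ℝ) w).add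
      (hzd.hasFDerivAt.smul ((hasFDerivAt_id (𝕜 := ℝ) w).const_sub p))
    refine h.congr_fderiv ?_
    ext <;> simp <;> ring
  have hmw : manin Fa Fb 4 p w = p + (1 - z w) • (w - p) := by
    simp only [manin, hz]
    module
  refine ⟨hm.differentiableAt, 1 - z w, hmw, ?_⟩
  rw [hm.fderiv, det_smul_id_add_smulRight]
  set m₂₃ := a₂ * b₃ - a₃ * b₂ with h₂₃
  set m₂₄ := a₂ * b₄ - a₄ * b₂ with h₂₄
  set m₃₄ := a₃ * b₄ - a₄ * b₃ with h₃₄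
  have hG (s : ℝ) : 2 * G1 Fa Fb p (p + s • (w - p)) =
      -2 * (m₂₃ * s ^ 5 + 2 * m₂₄ * s ^ 6 + m₃₄ * s ^ 7) := by
    simp only [G1, ha, hb, h₂₃, h₂₄, h₃₄]
    ring
  have hD (s : ℝ) : den Fa Fb 4 p (p + s • (w - p)) = -2 * (m₂₄ * s ^ 6 + m₃₄ * s ^ 7) := by
    simp only [den, G1, G2, ha, hb, h₂₄, h₃₄]
    push_cast
    ring
  have hw : p + (1 : ℝ) • (w - p) = w := by simp
  have hne : m₂₄ + m₃₄ ≠ 0 := by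
    have h := hD 1
    rw [hw] at h
    intro h'
    apply hden
    rw [h]
    linear_combination -2 * h'
  have hzw : z w = (m₂₃ + 2 * m₂₄ + m₃₄) / (m₂₄ + m₃₄) := by
    have h1 := hG 1
    have h2 := hD 1
    rw [hw] at h1 h2
    simp only [hz, h1, h2]
    rw [div_eq_div_iff (by simpa using hne) hne]
    ring
  have hrad : fderiv ℝ z w (w - p) =
      ((5 * m₂₃ + 12 * m₂₄ + 7 * m₃₄) * (m₂₄ + m₃₄)
        - (m₂₃ + 2 * m₂₄ + m₃₄) * (6 * m₂₄ + 7 * m₃₄)) / (m₂₄ + m₃₄) ^ 2 := by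
    have hline : HasDerivAt (fun s : ℝ => p + s • (w - p)) (w - p) 1 := by
      simpa using ((hasDerivAt_id (1 : ℝ)).smul_const (w - p)).const_add p
    have h1 : HasDerivAt (fun s : ℝ => z (p + s • (w - p))) (fderiv ℝ z w (w - p)) 1 := by
      have hzd' : HasFDerivAt z (fderiv ℝ z w) (p + (1 : ℝ) • (w - p)) := by
        rw [hw]
        exact hzd.hasFDerivAt
      exact hzd'.comp_hasDerivAt 1 hline
    have hpow (n : ℕ) : HasDerivAt (fun s : ℝ => s ^ n) (n : ℝ) 1 := by
      simpa using hasDerivAt_pow n (1 : ℝ)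
    have h2 := (((((hpow 5).const_mul m₂₃).add ((hpow 6).const_mul (2 * m₂₄))).add
      ((hpow 7).const_mul m₃₄)).const_mul (-2)).div
      ((((hpow 6).const_mul m₂₄).add ((hpow 7).const_mul m₃₄)).const_mul (-2))
      (by simpa using hne)
    have h3 := h1.unique (h2.congr_of_eventuallyEq (Filter.Eventually.of_forall fun s => by
      simp [hz, hG, hD]))
    rw [h3]
    simp
    field_simp
    ring
  have hFw : pev Fa w = a₂ + a₃ + a₄ := by
    have h := (ha 1).1
    rw [hw] at h
    simpa using h
  have hneg : fderiv ℝ z w (p - w) = -fderiv ℝ z w (w - p) := by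
    rw [← map_neg, neg_sub]
  rw [hmw, (ha _).1, hneg, hrad, hzw, hFw]
  have hpl : a₂ * m₃₄ - a₃ * m₂₄ + a₄ * m₂₃ = 0 := by
    rw [h₂₃, h₂₄, h₃₄]
    ring
  clear_value m₂₃ m₂₄ m₃₄
  field_simp
  linear_combination (m₂₃ + m₂₄) ^ 2 * (m₂₃ + 2 * m₂₄ + m₃₄) * hpl

theorem lineThrough_left (p q w : ℝ × ℝ) (t : ℝ) :
    lineThrough p q (p + t • (w - p)) = t * lineThrough p q w := by
  simp only [lineThrough, Prod.fst_add, Prod.snd_add, Prod.smul_fst, Prod.smul_snd, smul_eq_mul,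
    Prod.fst_sub, Prod.snd_sub]
  ring

theorem lineThrough_right (p q w : ℝ × ℝ) (t : ℝ) :
    lineThrough p q (q + t • (w - q)) = t * lineThrough p q w := by
  simp only [lineThrough, Prod.fst_add, Prod.snd_add, Prod.smul_fst, Prod.smul_snd, smul_eq_mul,
    Prod.fst_sub, Prod.snd_sub]
  ring

/-- for a quartic pencil with distinct double base points `p, q`,
the generalised Manin transformation `τ = ι_q ∘ ι_p` (with `D = 4`) is measure
preserving with density `L/F_a`: wherever defined,
`det (Dτ) = (L(w)·F_a(τ(w))) / (L(τ(w))·F_a(w))`. -/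
theorem manin_transformation_measure_preserving_quartic
    (Fa Fb : MvPolynomial (Fin 2) ℝ)
    (hFa : Fa.totalDegree ≤ 4) (hFb : Fb.totalDegree ≤ 4)
    (p q : ℝ × ℝ) (hpq : p ≠ q)
    (hpa : pev Fa p = 0)
    (hpau : pev (pderiv (0 : Fin 2) Fa) p = 0) (hpav : pev (pderiv (1 : Fin 2) Fa) p = 0)
    (hpb : pev Fb p = 0)
    (hpbu : pev (pderiv (0 : Fin 2) Fb) p = 0) (hpbv : pev (pderiv (1 : Fin 2) Fb) p = 0)
    (hqa : pev Fa q = 0)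
    (hqau : pev (pderiv (0 : Fin 2) Fa) q = 0) (hqav : pev (pderiv (1 : Fin 2) Fa) q = 0)
    (hqb : pev Fb q = 0)
    (hqbu : pev (pderiv (0 : Fin 2) Fb) q = 0) (hqbv : pev (pderiv (1 : Fin 2) Fb) q = 0)
    (τ : ℝ × ℝ → ℝ × ℝ) (hτ : τ = fun w => manin Fa Fb 4 q (manin Fa Fb 4 p w))
    (w : ℝ × ℝ)
    (hden1 : den Fa Fb 4 p w ≠ 0)
    (hden2 : den Fa Fb 4 q (manin Fa Fb 4 p w) ≠ 0)
    (h1 : pev Fa w * lineThrough p q (τ w) ≠ 0)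
    (h2 : pev Fa (τ w) ≠ 0)
    (h3 : lineThrough p q w ≠ 0) :
    DifferentiableAt ℝ τ w ∧
      (fderiv ℝ τ w).det =
        (lineThrough p q w * pev Fa (τ w)) / (lineThrough p q (τ w) * pev Fa w) := by
  obtain ⟨hdp, t, ht, hJp⟩ := manin_jacobian hFa hFb hpa hpau hpav hpb hpbu hpbv hden1
  obtain ⟨hdq, r, hr, hJq⟩ := manin_jacobian hFa hFb hqa hqau hqav hqb hqbu hqbv hden2
  have hcomp : τ = manin Fa Fb 4 q ∘ manin Fa Fb 4 p := hτ
  have hL : lineThrough p q (τ w) = r * (t * lineThrough p q w) := by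
    rw [hcomp, Function.comp_apply, hr, lineThrough_right, ht, lineThrough_left]
  have hFτ : pev Fa (τ w) = pev Fa (manin Fa Fb 4 q (manin Fa Fb 4 p w)) := by
    rw [hcomp, Function.comp_apply]
  refine ⟨hcomp ▸ hdq.comp w hdp, ?_⟩
  have hdet : (fderiv ℝ τ w).det = (fderiv ℝ (manin Fa Fb 4 q) (manin Fa Fb 4 p w)).det *
      (fderiv ℝ (manin Fa Fb 4 p) w).det := by
    rw [hcomp, fderiv_comp w hdq hdp]
    exact LinearMap.det_comp _ _
  rw [eq_div_iff (mul_comm (pev Fa w) _ ▸ h1), hdet, hL, hFτ, hJq, hJp]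
  ring
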